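/- For all ε, ε' ∈ ℝ: (a) the Lie algebras 𝔤_ε and 𝔤_{ε'} are isomorphic; an explicit isomorphism φ : 𝔤_ε → 𝔤_{ε'} is given by φ(e_i) = e_i for i = 1,…,5, φ(e_6) = e_6 + (2/3)(ε'−ε)e_2, φ(e_7) = e_7 + (2/7)(ε−ε')e_3; (b) if there exists a linear bijection φ : ℝ^7 → ℝ^7 which is a Lie algebra isomorphism from 𝔤_ε to 𝔤_{ε'} and satisfies ⟨φ(x),φ(y)⟩ = ⟨x,y⟩ for all x,y ∈ ℝ^7, then ε = ε'. -/

import Mathlib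

open Matrix

noncomputable section

abbrev V7 : Type := Fin 7 → ℝ
abbrev M7 : Type := Matrix (Fin 7) (Fin 7) ℝ
abbrev M2 : Type := Matrix (Fin 2) (Fin 2) ℝ

/-- The standard basis of `ℝ^7` (0-indexed: `e 0` is `e_1` of the paper). -/
def e (i : Fin 7) : V7 := Pi.single i 1

/-- The symmetric bilinear form of signature (4,3):
`⟨e_1,e_5⟩ = ⟨e_2,e_6⟩ = ⟨e_3,e_7⟩ = 1`, `⟨e_4,e_4⟩ = −1`. -/
def ip (u v : V7) : ℝ :=
  u 0 * v 4 + u 4 * v 0 + u 1 * v 5 + u 5 * v 1 + u 2 * v 6 + u 6 * v 2 - u 3 * v 3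

/-- Structure constants of the Lie algebra `𝔤_ε` : `cEps ε i j = [e_{i+1}, e_{j+1}]`. -/
def cEps (ε : ℝ) : Fin 7 → Fin 7 → V7 :=
  ![![0, 0, 0, 0, (1/2 : ℝ) • e 0, 0, 0],
    ![0, 0, 0, 0, -((1/2 : ℝ) • e 1), -((1/2 : ℝ) • e 0), 0],
    ![0, 0, 0, 0, (2 : ℝ) • e 2, 0, -((1/2 : ℝ) • e 0)],
    ![0, 0, 0, 0, -(e 1), -(e 0), 0],
    ![-((1/2 : ℝ) • e 0), (1/2 : ℝ) • e 1, -((2 : ℝ) • e 2), e 1, 0,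
      -(ε • e 1) - (2 : ℝ) • e 3 - e 5, -(ε • e 2) + (3/2 : ℝ) • e 6],
    ![0, (1/2 : ℝ) • e 0, 0, e 0, ε • e 1 + (2 : ℝ) • e 3 + e 5, 0,
      -(Real.sqrt 2 • e 1)],
    ![0, 0, (1/2 : ℝ) • e 0, 0, ε • e 2 - (3/2 : ℝ) • e 6, Real.sqrt 2 • e 1, 0]]

/-- The bracket of `𝔤_ε`, the bilinear extension of the structure constants. -/
def bkEps (ε : ℝ) (x y : V7) : V7 :=
  ∑ i : Fin 7, ∑ j : Fin 7, (x i * y j) • cEps ε i j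

theorem e_apply (i j : Fin 7) : e i j = if j = i then 1 else 0 := by
  simp [e, Pi.single_apply]

theorem bkEps_eq (ε : ℝ) (x y : V7) : bkEps ε x y =
    ![1/2 * (x 0 * y 4 - x 4 * y 0) - 1/2 * (x 1 * y 5 - x 5 * y 1)
        - 1/2 * (x 2 * y 6 - x 6 * y 2) - (x 3 * y 5 - x 5 * y 3),
      -1/2 * (x 1 * y 4 - x 4 * y 1) - (x 3 * y 4 - x 4 * y 3) - ε * (x 4 * y 5 - x 5 * y 4)
        - Real.sqrt 2 * (x 5 * y 6 - x 6 * y 5),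
      2 * (x 2 * y 4 - x 4 * y 2) - ε * (x 4 * y 6 - x 6 * y 4),
      -2 * (x 4 * y 5 - x 5 * y 4),
      0,
      -(x 4 * y 5 - x 5 * y 4),
      3/2 * (x 4 * y 6 - x 6 * y 4)] := by
  ext k
  fin_cases k <;> simp [bkEps, cEps, Fin.sum_univ_seven, e_apply] <;> ring

/-- The adjoint operator `y ↦ [x, y]` of `𝔤_ε`. -/
def adEps (ε : ℝ) (x : V7) : V7 →ₗ[ℝ] V7 where
  toFun := bkEps ε x
  map_add' y z := by
    simp [bkEps, mul_add, add_smul, Finset.sum_add_distrib]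
  map_smul' c y := by
    simp only [bkEps, Finset.smul_sum, smul_smul, Pi.smul_apply, smul_eq_mul, RingHom.id_apply]
    simp only [mul_left_comm]

theorem adEps_apply (ε : ℝ) (x y : V7) : adEps ε x y = bkEps ε x y := rfl

theorem trace_adEps (ε : ℝ) (x : V7) : LinearMap.trace ℝ V7 (adEps ε x) = -3/2 * x 4 := by
  rw [LinearMap.trace_eq_matrix_trace ℝ (Pi.basisFun ℝ (Fin 7))]
  simp only [Matrix.trace, Matrix.diag, LinearMap.toMatrix_apply, Pi.basisFun_apply,
    Pi.basisFun_repr, Fin.sum_univ_seven, adEps_apply, bkEps_eq]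
  simp
  ring

/-- A Lie algebra isomorphism preserves the trace of the adjoint operators, hence the
coordinate along `e 4`. -/
theorem map_apply_four {ε ε' : ℝ} (φ : V7 →ₗ[ℝ] V7) (hφ : Function.Bijective φ)
    (hbk : ∀ x y : V7, φ (bkEps ε x y) = bkEps ε' (φ x) (φ y)) (x : V7) : φ x 4 = x 4 := by
  let Φ := LinearEquiv.ofBijective φ hφ
  have hconj : Φ.conj (adEps ε x) = adEps ε' (φ x) := by
    refine LinearMap.ext fun y => ?_
    obtain ⟨z, rfl⟩ := Φ.surjective y
    rw [LinearEquiv.conj_apply_apply, LinearEquiv.symm_apply_apply]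
    exact hbk x z
  have h := LinearMap.trace_conj' (adEps ε x) Φ
  rw [hconj, trace_adEps, trace_adEps] at h
  linarith

theorem exists_isomorphism (ε ε' : ℝ) :
    ∃ φ : V7 →ₗ[ℝ] V7, Function.Bijective φ ∧
      (∀ i : Fin 7, i.val < 5 → φ (e i) = e i) ∧
      φ (e 5) = e 5 + ((2/3) * (ε' - ε)) • e 1 ∧
      φ (e 6) = e 6 + ((2/7) * (ε - ε')) • e 2 ∧
      (∀ x y : V7, φ (bkEps ε x y) = bkEps ε' (φ x) (φ y)) := by
  let φ : V7 →ₗ[ℝ] V7 := LinearMap.id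
    + (LinearMap.proj 5).smulRight (((2/3) * (ε' - ε)) • e 1)
    + (LinearMap.proj 6).smulRight (((2/7) * (ε - ε')) • e 2)
  have hφ (x : V7) :
      φ x = x + x 5 • (((2/3) * (ε' - ε)) • e 1) + x 6 • (((2/7) * (ε - ε')) • e 2) := rfl
  have hinj : Function.Injective φ := by
    rw [injective_iff_map_eq_zero]
    intro x hx
    have h (k : Fin 7) : φ x k = 0 := by rw [hx]; rfl
    have h5 : x 5 = 0 := by simpa [hφ, e_apply] using h 5
    have h6 : x 6 = 0 := by simpa [hφ, e_apply] using h 6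
    simpa [hφ, h5, h6] using hx
  refine ⟨φ, ⟨hinj, LinearMap.injective_iff_surjective.1 hinj⟩, ?_, ?_, ?_, ?_⟩
  · intro i hi
    have h5 : (5 : Fin 7) ≠ i := by rintro rfl; simp at hi
    have h6 : (6 : Fin 7) ≠ i := by rintro rfl; simp at hi
    simp [hφ, e_apply, h5, h6]
  · simp [hφ, e_apply]
  · simp [hφ, e_apply]
  · intro x y
    ext k
    rw [bkEps_eq ε', hφ, hφ, hφ]
    simp only [Pi.add_apply, Pi.smul_apply, smul_eq_mul, e_apply]
    fin_cases k <;> simp [bkEps_eq] <;> ring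

theorem eq_of_isometric_isomorphism {ε ε' : ℝ} (φ : V7 →ₗ[ℝ] V7) (hφ : Function.Bijective φ)
    (hbk : ∀ x y : V7, φ (bkEps ε x y) = bkEps ε' (φ x) (φ y))
    (hip : ∀ x y : V7, ip (φ x) (φ y) = ip x y) : ε = ε' := by
  have h4 := map_apply_four φ hφ hbk
  have hF24 : φ (e 2) 4 = 0 := by simp [h4, e_apply]
  have hF44 : φ (e 4) 4 = 1 := by simp [h4, e_apply]
  have hF54 : φ (e 5) 4 = 0 := by simp [h4, e_apply]
  have hF64 : φ (e 6) 4 = 0 := by simp [h4, e_apply]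
  -- `e 3 + 2 • e 1` spans, together with `e 0`, the orthogonal complement of `[𝔤, 𝔤]`.
  obtain ⟨q, hq⟩ : ∃ q, q = φ (e 3 + (2 : ℝ) • e 1) := ⟨_, rfl⟩
  have hq4 : q 4 = 0 := by simp [hq, h4, e_apply]
  have horth (x y : V7) : ip q (bkEps ε' x y) = 0 := by
    obtain ⟨x, rfl⟩ := hφ.2 x
    obtain ⟨y, rfl⟩ := hφ.2 y
    rw [hq, ← hbk, hip, bkEps_eq]
    simp [ip, e_apply]
    ring
  have hq6 : q 6 = 0 := by
    simpa [ip, bkEps_eq, e_apply] using horth (e 2) (e 4)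
  have hq5 : q 5 = 0 := by
    simpa [ip, bkEps_eq, e_apply, hq4] using horth (e 3) (e 4)
  have hq2 : q 2 = 0 := by
    simpa [ip, bkEps_eq, e_apply, hq6] using horth (e 4) (e 6)
  have hq1 : q 1 = 2 * q 3 := by
    have := horth (e 4) (e 5)
    simp [ip, bkEps_eq, e_apply, hq5] at this
    linarith
  have hqq : q 3 * q 3 = 1 := by
    have h : ip q q = ip (e 3 + (2 : ℝ) • e 1) (e 3 + (2 : ℝ) • e 1) := by rw [hq, hip]
    simpa [ip, e_apply, hq4, hq5, hq6] using h
  have hF1 : (2 : ℝ) • φ (e 1) = bkEps ε' (φ (e 4)) q := by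
    rw [hq, ← hbk, ← map_smul]
    congr 1
    ext k
    fin_cases k <;> simp [bkEps_eq, e_apply]
    norm_num
  have hF1k (k : Fin 7) : 2 * φ (e 1) k = bkEps ε' (φ (e 4)) q k := by rw [← hF1]; rfl
  have hF11 : φ (e 1) 1 = q 3 := by
    have := hF1k 1
    simp [bkEps_eq, hF44, hq1, hq4, hq5, hq6] at this
    linarith
  have hF12 : φ (e 1) 2 = 0 := by simpa [bkEps_eq, hq2, hq4, hq6] using hF1k 2
  have hF13 : φ (e 1) 3 = 0 := by simpa [bkEps_eq, hq4, hq5] using hF1k 3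
  have hF14 : φ (e 1) 4 = 0 := by simp [h4, e_apply]
  have hF15 : φ (e 1) 5 = 0 := by simpa [bkEps_eq, hq4, hq5] using hF1k 5
  have hF16 : φ (e 1) 6 = 0 := by simpa [bkEps_eq, hq4, hq6] using hF1k 6
  have hF2 : (-2 : ℝ) • φ (e 2) = bkEps ε' (φ (e 4)) (φ (e 2)) := by
    rw [← hbk, ← map_smul]
    congr 1
    ext k
    fin_cases k <;> simp [bkEps_eq, e_apply]
  have hF2k (k : Fin 7) : -2 * φ (e 2) k = bkEps ε' (φ (e 4)) (φ (e 2)) k := by rw [← hF2]; rfl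
  have hF25 : φ (e 2) 5 = 0 := by
    have := hF2k 5
    simp [bkEps_eq, hF44, hF24] at this
    linarith
  have hF23 : φ (e 2) 3 = 0 := by
    have := hF2k 3
    simpa [bkEps_eq, hF44, hF24, hF25] using this
  have hF26 : φ (e 2) 6 = 0 := by
    have := hF2k 6
    simp [bkEps_eq, hF44, hF24] at this
    linarith
  have hF6 : (3/2 : ℝ) • φ (e 6) - ε • φ (e 2) = bkEps ε' (φ (e 4)) (φ (e 6)) := by
    rw [← hbk, ← map_smul, ← map_smul, ← map_sub]
    congr 1
    ext k
    fin_cases k <;> simp [bkEps_eq, e_apply]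
  have hF6k (k : Fin 7) : 3/2 * φ (e 6) k - ε * φ (e 2) k = bkEps ε' (φ (e 4)) (φ (e 6)) k := by
    rw [← hF6]; rfl
  have hF65 : φ (e 6) 5 = 0 := by
    have := hF6k 5
    simp [bkEps_eq, hF44, hF64, hF25] at this
    linarith
  have hF63 : φ (e 6) 3 = 0 := by
    have := hF6k 3
    simpa [bkEps_eq, hF44, hF64, hF65, hF23] using this
  have h26 : φ (e 2) 2 * φ (e 6) 6 = 1 := by
    simpa [ip, e_apply, hF24, hF25, hF23, hF26, hF64, hF65, hF63] using hip (e 2) (e 6)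
  have h66 : φ (e 6) 2 * φ (e 6) 6 = 0 := by
    have := hip (e 6) (e 6)
    simp [ip, e_apply, hF64, hF65, hF63] at this
    linarith
  have hF62 : φ (e 6) 2 = 0 :=
    (mul_eq_zero.1 h66).resolve_right (right_ne_zero_of_mul_eq_one h26)
  have hε : ε * φ (e 2) 2 = ε' * φ (e 6) 6 := by
    have := hF6k 2
    simp [bkEps_eq, hF44, hF64, hF62] at this
    linarith
  have h15 : q 3 * φ (e 5) 5 = 1 := by
    simpa [ip, e_apply, hF11, hF12, hF13, hF14, hF15, hF16, hF54] using hip (e 1) (e 5)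
  have h56 : φ (e 5) 5 * φ (e 6) 6 = q 3 := by
    have h : -(Real.sqrt 2 • φ (e 1)) = bkEps ε' (φ (e 5)) (φ (e 6)) := by
      rw [← hbk, ← map_smul, ← map_neg]
      congr 1
      ext k
      fin_cases k <;> simp [bkEps_eq, e_apply]
    have h1 := congrFun h 1
    simpa [bkEps_eq, hF54, hF64, hF65, hF11, eq_comm (a := q 3), eq_comm (a := (0 : ℝ))] using h1
  have hF66 : φ (e 6) 6 = 1 := by
    linear_combination q 3 * h56 - φ (e 6) 6 * h15 + hqq
  rw [hF66, mul_one] at h26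
  simpa [hF66, h26] using hε

theorem stmt19 (ε ε' : ℝ) :
    (∃ φ : V7 →ₗ[ℝ] V7, Function.Bijective φ ∧
      (∀ i : Fin 7, i.val < 5 → φ (e i) = e i) ∧
      φ (e 5) = e 5 + ((2/3) * (ε' - ε)) • e 1 ∧
      φ (e 6) = e 6 + ((2/7) * (ε - ε')) • e 2 ∧
      (∀ x y : V7, φ (bkEps ε x y) = bkEps ε' (φ x) (φ y))) ∧
    (∀ φ : V7 →ₗ[ℝ] V7, Function.Bijective φ →
      (∀ x y : V7, φ (bkEps ε x y) = bkEps ε' (φ x) (φ y)) →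
      (∀ x y : V7, ip (φ x) (φ y) = ip x y) → ε = ε') := by
  exact ⟨exists_isomorphism ε ε', eq_of_isometric_isomorphism⟩
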